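/- Let G be an α_i-metric graph and let x,y be mutually distant vertices (i.e., e(x)=e(y)=d(x,y)). Then there exists a vertex c in the middle slice S_{⌊d(x,y)/2⌋}(x,y) with e(c) ≤ rad(G)+i, and every vertex z in this slice satisfies e(z) ≤ rad(G)+2i+1. -/

import Mathlib

open SimpleGraph

variable {V : Type*}

/-- `Itv G u v x` means `x` lies on a shortest `(u,v)`-path, i.e. `x ∈ I(u,v)`. -/
def Itv (G : SimpleGraph V) (u v x : V) : Prop :=
  G.dist u x + G.dist x v = G.dist u v

/-- `G` is an `α_i`-metric graph. -/
def AlphaI (G : SimpleGraph V) (i : ℕ) : Prop :=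
  ∀ u v w x : V, Itv G u w v → Itv G v x w → G.Adj v w →
    G.dist u v + G.dist v x ≤ G.dist u x + i

/-- Eccentricity of a vertex. -/
noncomputable def ecc (G : SimpleGraph V) [Fintype V] (v : V) : ℕ :=
  Finset.univ.sup (fun u => G.dist v u)

/-- Radius of the graph. -/
noncomputable def grad (G : SimpleGraph V) [Fintype V] [Nonempty V] : ℕ :=
  Finset.univ.inf' Finset.univ_nonempty (fun v => ecc G v)

/-- Diameter of the graph. -/
noncomputable def gdiam (G : SimpleGraph V) [Fintype V] : ℕ :=
  Finset.univ.sup (fun v => ecc G v)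

theorem exists_adj_dist_add_one_eq {G : SimpleGraph V} (hG : G.Connected) {a b : V}
    (hab : G.dist a b ≠ 0) : ∃ c, G.Adj a c ∧ G.dist c b + 1 = G.dist a b := by
  obtain ⟨p, hp⟩ := hG.exists_walk_length_eq_dist a b
  cases p with
  | nil => simp at hab
  | @cons _ c _ h q =>
    refine ⟨c, h, ?_⟩
    have h1 := G.dist_le q
    have h2 := hG.dist_triangle (u := a) (v := c) (w := b)
    rw [dist_eq_one_iff_adj.mpr h] at h2
    rw [Walk.length_cons] at hp
    omega

theorem exists_itv_dist_eq {G : SimpleGraph V} (hG : G.Connected) (x y : V) (k : ℕ)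
    (hk : k ≤ G.dist x y) : ∃ c, Itv G x y c ∧ G.dist x c = k := by
  induction k with
  | zero => exact ⟨x, by simp [Itv], by simp⟩
  | succ k ih =>
    obtain ⟨c, hc, hck⟩ := ih (by omega)
    unfold Itv at hc
    obtain ⟨d, hcd, hd⟩ := exists_adj_dist_add_one_eq hG (a := c) (b := y) (by omega)
    have h1 := hG.dist_triangle (u := x) (v := c) (w := d)
    have h2 := hG.dist_triangle (u := x) (v := d) (w := y)
    rw [dist_eq_one_iff_adj.mpr hcd] at h1
    refine ⟨d, ?_, ?_⟩
    · unfold Itv; omega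
    · omega

theorem AlphaI.dist_add_dist_le {G : SimpleGraph V} {i : ℕ} (hα : AlphaI G i) {u v w x : V}
    (hvw : G.Adj v w) (hu : G.dist u w = G.dist u v + 1) (hx : G.dist v x = G.dist w x + 1) :
    G.dist u v + G.dist v x ≤ G.dist u x + i := by
  have h1 := dist_eq_one_iff_adj.mpr hvw
  exact hα u v w x (by unfold Itv; omega) (by unfold Itv; omega) hvw

/-- Slices of intervals in an `α_i`-metric graph have diameter at most `i + 1`. -/
theorem AlphaI.dist_le_of_mem_slice {G : SimpleGraph V} (hG : G.Connected) {i : ℕ}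
    (hα : AlphaI G i) {x y : V} (k : ℕ) {z z' : V} (hz : Itv G x y z) (hzk : G.dist x z = k)
    (hz' : Itv G x y z') (hzk' : G.dist x z' = k) : G.dist z z' ≤ i + 1 := by
  induction k generalizing z z' with
  | zero =>
    rw [hG.dist_eq_zero_iff] at hzk hzk'
    simp [← hzk, ← hzk']
  | succ k ih =>
    by_contra! hlt
    unfold Itv at hz hz' ih
    have toward : ∀ a : V, G.dist x a = k + 1 → G.dist x a + G.dist a y = G.dist x y →
        ∃ p, G.Adj a p ∧ G.dist x p = k ∧ G.dist y p = G.dist y a + 1 := by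
      intro a ha hay
      rw [G.dist_comm] at ha
      obtain ⟨p, hap, hp⟩ := exists_adj_dist_add_one_eq hG (a := a) (b := x) (by omega)
      rw [G.dist_comm (u := p)] at hp
      have h1 := hG.dist_triangle (u := x) (v := p) (w := y)
      have h2 := hG.dist_triangle (u := p) (v := a) (w := y)
      rw [dist_eq_one_iff_adj.mpr hap.symm] at h2
      rw [G.dist_comm (u := a) (v := x)] at hp ha
      have hya := G.dist_comm (u := y) (v := a)
      have hyp := G.dist_comm (u := y) (v := p)
      exact ⟨p, hap, by omega, by omega⟩
    obtain ⟨p, hzp, hp, hyp⟩ := toward z hzk hz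
    obtain ⟨p', hzp', hp', hyp'⟩ := toward z' hzk' hz'
    have hyz := G.dist_comm (u := y) (v := z)
    have hyz' := G.dist_comm (u := y) (v := z')
    have hpy := G.dist_comm (u := y) (v := p)
    have hpy' := G.dist_comm (u := y) (v := p')
    have hpp := ih (z := p) (z' := p') (by omega) hp (by omega) hp'
    have h1 := hG.dist_triangle (u := p) (v := p') (w := z')
    have h2 := hG.dist_triangle (u := z) (v := p) (w := z')
    rw [dist_eq_one_iff_adj.mpr hzp'.symm] at h1
    rw [dist_eq_one_iff_adj.mpr hzp] at h2
    have hc := G.dist_comm (u := p) (v := z')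
    have hc' := G.dist_comm (u := p) (v := p')
    have hfar : G.dist z z' ≤ G.dist p z' := by
      by_contra! h
      have := hα.dist_add_dist_le (x := z') hzp hyp (by omega)
      omega
    have := hα.dist_add_dist_le (x := p) hzp' hyp' (by omega)
    omega

theorem dist_le_ecc [Fintype V] (G : SimpleGraph V) (u v : V) : G.dist u v ≤ ecc G u :=
  Finset.le_sup (f := fun w => G.dist u w) (Finset.mem_univ v)

theorem dist_le_two_mul_grad [Fintype V] [Nonempty V] {G : SimpleGraph V} (hG : G.Connected)
    (u v : V) : G.dist u v ≤ 2 * grad G := by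
  obtain ⟨m, -, hm⟩ := Finset.exists_mem_eq_inf' Finset.univ_nonempty (fun v : V => ecc G v)
  change grad G = ecc G m at hm
  have h1 := hG.dist_triangle (u := u) (v := m) (w := v)
  rw [G.dist_comm (u := u) (v := m)] at h1
  have h2 := dist_le_ecc G m u
  have h3 := dist_le_ecc G m v
  omega

theorem AlphaI.exists_ecc_le [Fintype V] [Nonempty V] {G : SimpleGraph V} (hG : G.Connected)
    {i : ℕ} (hα : AlphaI G i) {x y : V} (hx : ecc G x = G.dist x y)
    (hy : ecc G y = G.dist x y) :
    ∃ c, Itv G x y c ∧ G.dist x c = G.dist x y / 2 ∧ ecc G c ≤ grad G + i := by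
  classical
  let excess : V → ℕ := fun c => ∑ u, (G.dist c u - (grad G + i))
  let slice := Finset.univ.filter fun c => Itv G x y c ∧ G.dist x c = G.dist x y / 2
  have hne : slice.Nonempty := by
    obtain ⟨c, hc⟩ := exists_itv_dist_eq hG x y (G.dist x y / 2) (Nat.div_le_self _ _)
    exact ⟨c, by simpa [slice] using hc⟩
  obtain ⟨c, hc, hmin⟩ := slice.exists_min_image excess hne
  simp only [slice, Finset.mem_filter, Finset.mem_univ, true_and] at hc hmin
  obtain ⟨hcI, hck⟩ := hc
  refine ⟨c, hcI, hck, Finset.sup_le fun v _ => ?_⟩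
  by_contra! hv
  unfold Itv at hcI hmin
  have hD := dist_le_two_mul_grad hG x y
  obtain ⟨c', hcc', hc'v⟩ := exists_adj_dist_add_one_eq hG (a := c) (b := v) (by omega)
  have stay : ∀ u, G.dist u v < G.dist u c + G.dist c v - i → G.dist u c' ≤ G.dist u c := by
    intro u hu
    by_contra! h
    have h1 := hG.dist_triangle (u := u) (v := c) (w := c')
    rw [dist_eq_one_iff_adj.mpr hcc'] at h1
    have := hα.dist_add_dist_le (u := u) (x := v) hcc' (by omega) (by omega)
    omega
  have hxv := dist_le_ecc G x v
  have hyv := dist_le_ecc G y v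
  have hcy := G.dist_comm (u := c) (v := y)
  have hcy' := G.dist_comm (u := c') (v := y)
  have hxc' := stay x (by omega)
  have hyc' := stay y (by omega)
  have htri := hG.dist_triangle (u := x) (v := c') (w := y)
  refine (hmin c' ⟨by omega, by omega⟩).not_gt (Finset.sum_lt_sum (fun u _ => ?_)
    ⟨v, Finset.mem_univ v, by omega⟩)
  have huv := dist_le_two_mul_grad hG u v
  have huc := G.dist_comm (u := c) (v := u)
  have huc' := G.dist_comm (u := c') (v := u)
  have h1 := hG.dist_triangle (u := u) (v := c) (w := c')
  rw [dist_eq_one_iff_adj.mpr hcc'] at h1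
  by_cases h : G.dist c u < grad G + i
  · omega
  · have := stay u (by omega)
    omega

theorem stmt_7 [Fintype V] [Nonempty V] (G : SimpleGraph V) (hG : G.Connected) (i : ℕ)
    (hα : AlphaI G i) (x y : V)
    (hx : ecc G x = G.dist x y) (hy : ecc G y = G.dist x y) :
    (∃ c : V, Itv G x y c ∧ G.dist x c = G.dist x y / 2 ∧ ecc G c ≤ grad G + i) ∧
    (∀ z : V, Itv G x y z → G.dist x z = G.dist x y / 2 →
      ecc G z ≤ grad G + 2 * i + 1) := by
  have hcenter := hα.exists_ecc_le hG hx hy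
  refine ⟨hcenter, fun z hz hzk => Finset.sup_le fun v _ => ?_⟩
  obtain ⟨c, hc, hck, hce⟩ := hcenter
  have h1 := hα.dist_le_of_mem_slice hG _ hz hzk hc hck
  have h2 := hG.dist_triangle (u := z) (v := c) (w := v)
  have h3 := dist_le_ecc G c v
  omega
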